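/- Fix z ∈ ℂ and an integer k ≥ 1. Let P be the ℂ-valued function on compositions supported on the single-part compositions (nk) for n ≥ 1, with P((nk)) := −(−z)ⁿ/n, and P = 0 on all other compositions (in particular P(ε) = 0). The stuffle powers P^{⧛m} and the stuffle exponential exp_⧛(P) := Σ_{m≥0} P^{⧛m}/m! are well defined coefficientwise, since P^{⧛m} vanishes on every composition of weight < mk, so each coefficient of exp_⧛(P) is a finite sum. Then exp_⧛(P) = (z·y_k)*, i.e. for every composition w: exp_⧛(P)(w) = z^{length(w)} if every part of w equals k, and exp_⧛(P)(w) = 0 otherwise. -/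

import Mathlib

open scoped NNReal ENNReal

/-- A composition: a finite list of positive integers. -/
abbrev Comp := List ℕ+

/-- Stuffle coefficient on compositions: `⟨u ⧛ v, w⟩`, defined by
`u ⧛ ε = ε ⧛ u = u` and
`(s::u) ⧛ (t::v) = s::(u ⧛ (t::v)) + t::((s::u) ⧛ v) + (s+t)::(u ⧛ v)`. -/
def stuf : Comp → Comp → Comp → ℤ
  | [], v, w => if w = v then 1 else 0
  | u, [], w => if w = u then 1 else 0
  | _ :: _, _ :: _, [] => 0
  | s :: u, t :: v, c :: w =>
      (if c = s then stuf u (t :: v) w else 0) +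
      (if c = t then stuf (s :: u) v w else 0) +
      (if c = s + t then stuf u v w else 0)
termination_by u v _ => u.length + v.length

/-- Bilinear extension of the stuffle to `ℂ`-valued functions on compositions
(a finite sum for each `w`, realized as a `tsum`). -/
noncomputable def stufA (α β : Comp → ℂ) : Comp → ℂ :=
  fun w => ∑' p : Comp × Comp, α p.1 * β p.2 * (stuf p.1 p.2 w : ℂ)

/-- Stuffle powers `P^{⧛m}` of a function on compositions. -/
noncomputable def stufPow (P : Comp → ℂ) : ℕ → Comp → ℂ
  | 0 => fun w => if w = [] then 1 else 0
  | m + 1 => stufA P (stufPow P m)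

/-- The stuffle exponential `exp_⧛(P) = Σ_{m≥0} P^{⧛m}/m!`, defined
coefficientwise (each coefficient is a finite sum, realized as a `tsum`,
since `P^{⧛m}` vanishes on compositions of small weight when `P(ε) = 0`). -/
noncomputable def expStuf (P : Comp → ℂ) : Comp → ℂ :=
  fun w => ∑' m : ℕ, stufPow P m w / (m.factorial : ℂ)

/-- The function supported on single-part compositions `(nk)`, `n ≥ 1`, with
value `−(−z)ⁿ/n` there and `0` elsewhere. -/
noncomputable def Pfun (z : ℂ) (k : ℕ+) : Comp → ℂ
  | [m] =>
      if (k : ℕ) ∣ (m : ℕ) then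
        -(-z) ^ ((m : ℕ) / (k : ℕ)) / (((m : ℕ) / (k : ℕ) : ℕ) : ℂ)
      else 0
  | _ => 0

/-- Prepend a natural number, dropping it if it is zero. -/
def preN (t : ℕ) (w : Comp) : Comp := if 0 < t then t.toPNat' :: w else w

lemma preN_coe (c : ℕ+) (w : Comp) : preN (c : ℕ) w = c :: w := by
  rw [preN, if_pos c.pos, PNat.coe_toPNat']

/-- Recursive form of stuffling by a function supported on single letters. -/
noncomputable def TT (a : ℕ → ℂ) : (Comp → ℂ) → Comp → ℂ
  | _, [] => 0
  | β, c :: w => ∑ i ∈ Finset.range (c : ℕ), a (i + 1) * β (preN ((c : ℕ) - (i + 1)) w)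
      + TT a (fun v => β (c :: v)) w

lemma TT_sum {ι : Type} (a : ℕ → ℂ) (F : Finset ι) (g : ι → ℂ) (f : ι → Comp → ℂ) (w : Comp) :
    TT a (fun v => ∑ i ∈ F, g i * f i v) w = ∑ i ∈ F, g i * TT a (f i) w := by
  induction w generalizing f with
  | nil => simp [TT]
  | cons c w ih =>
    simp only [TT]
    rw [ih]
    simp only [mul_add, Finset.sum_add_distrib, Finset.mul_sum]
    rw [Finset.sum_comm]
    congr 1
    refine Finset.sum_congr rfl fun i _ => Finset.sum_congr rfl fun j _ => by ring

lemma stuf_single_nil (s : ℕ+) (v : Comp) : stuf [s] v [] = 0 := by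
  cases v <;> simp [stuf]

lemma stuf_single_cons (s : ℕ+) (v : Comp) (c : ℕ+) (w : Comp) :
    stuf [s] v (c :: w) = (if (s : ℕ) ≤ c ∧ v = preN ((c : ℕ) - s) w then 1 else 0) +
      (match v with
        | [] => 0
        | t :: v' => if c = t then stuf [s] v' w else 0) := by
  have key : ∀ t : ℕ+, (c = s + t) ↔ ((s : ℕ) < c ∧ (t : ℕ) = c - s) := by
    intro t
    rw [← PNat.coe_inj, PNat.add_coe]
    have := t.pos
    omega
  rcases lt_trichotomy (c : ℕ) s with h | h | h
  · have h1 : c ≠ s := by rintro rfl; omega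
    cases v with
    | nil =>
      have h3 : ¬ ((s : ℕ) ≤ c) := by omega
      simp only [h3, false_and, if_false]
      simp [stuf, h1]
    | cons t v =>
      have : ¬ (c = s + t) := by rw [key]; omega
      have h3 : ¬ ((s : ℕ) ≤ c) := by omega
      simp only [h3, false_and, if_false]
      simp [stuf, h1, this]
  · have h1 : c = s := PNat.coe_inj.1 h
    subst h1
    cases v with
    | nil => simp [stuf, preN, eq_comm]
    | cons t v =>
      have : ¬ (c = c + t) := by rw [key]; omega
      simp [stuf, this, preN, eq_comm]
  · have h1 : c ≠ s := by rintro rfl; omega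
    have h2 : 0 < (c : ℕ) - s := by omega
    cases v with
    | nil => simp [stuf, h1, preN, h2]
    | cons t v =>
      have e : (c = s + t ∧ w = v) ↔ ((s : ℕ) ≤ c ∧ t :: v = preN ((c : ℕ) - s) w) := by
        rw [key]
        rw [preN, if_pos h2, List.cons.injEq, ← PNat.coe_inj, Nat.toPNat'_coe, if_pos h2]
        constructor
        · rintro ⟨⟨_, a⟩, b⟩; exact ⟨by omega, a, b.symm⟩
        · rintro ⟨_, a, b⟩; exact ⟨⟨h, a⟩, b.symm⟩
      simp only [stuf, h1, if_false, zero_add, ← e, ite_and]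
      ring

lemma hasSum_single_stuf (a : ℕ → ℂ) (β : Comp → ℂ) (w : Comp) :
    HasSum (fun p : ℕ+ × Comp => a p.1 * β p.2 * (stuf [p.1] p.2 w : ℂ)) (TT a β w) := by
  induction w generalizing β with
  | nil => simp [stuf_single_nil, TT, hasSum_zero]
  | cons c w ih =>
    simp only [TT]
    have h1 : HasSum (fun p : ℕ+ × Comp => a p.1 * β p.2 *
        (if (p.1 : ℕ) ≤ c ∧ p.2 = preN ((c : ℕ) - p.1) w then (1 : ℂ) else 0))
        (∑ i ∈ Finset.range (c : ℕ), a (i + 1) * β (preN ((c : ℕ) - (i + 1)) w)) := by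
      let g : Fin (c : ℕ) → ℕ+ × Comp := fun i =>
        (⟨i + 1, Nat.succ_pos _⟩, preN ((c : ℕ) - (i + 1)) w)
      have hg : Function.Injective g := by
        intro i j hij
        have := congrArg (fun p : ℕ+ × Comp => (p.1 : ℕ)) hij
        simp only [g, PNat.mk_coe] at this
        exact Fin.ext (by omega)
      rw [← hg.hasSum_iff]
      · rw [Finset.sum_range]
        convert hasSum_fintype _ using 1
        refine Finset.sum_congr rfl fun i _ => ?_
        have : (i : ℕ) + 1 ≤ c := i.2
        simp only [Function.comp, g, PNat.mk_coe, this, true_and, if_true, mul_one]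
      · rintro ⟨s, v⟩ hp
        rw [if_neg, mul_zero]
        rintro ⟨h1, h2⟩
        apply hp
        have := s.pos
        simp only at h1 h2
        refine ⟨⟨(s : ℕ) - 1, by omega⟩, ?_⟩
        have e : (s : ℕ) - 1 + 1 = s := by omega
        simp only [g, e, h2]
        rfl
    have h2 : HasSum (fun p : ℕ+ × Comp => a p.1 * β p.2 *
        ((match p.2 with
        | [] => 0
        | t :: v' => if c = t then stuf [p.1] v' w else 0 : ℤ) : ℂ))
        (TT a (fun v => β (c :: v)) w) := by
      let g : ℕ+ × Comp → ℕ+ × Comp := fun p => (p.1, c :: p.2)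
      have hg : Function.Injective g := by
        rintro ⟨s, v⟩ ⟨s', v'⟩ h
        simpa [g] using h
      rw [← hg.hasSum_iff]
      · convert ih (fun v => β (c :: v)) using 2 with p
        simp [g]
      · rintro ⟨s, v⟩ hp
        cases v with
        | nil => simp
        | cons t v =>
          have : c ≠ t := by
            rintro rfl
            exact hp ⟨(s, v), rfl⟩
          simp [this]
    convert h1.add h2 using 2 with p
    rw [stuf_single_cons]
    push_cast
    ring

/-- The one-letter coefficients of `Pfun`. -/
noncomputable def aa (z : ℂ) (k : ℕ+) (m : ℕ) : ℂ :=
  if (k : ℕ) ∣ m then -(-z) ^ (m / (k : ℕ)) / ((m / (k : ℕ) : ℕ) : ℂ) else 0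

lemma aa_zero (z : ℂ) (k : ℕ+) : aa z k 0 = 0 := by simp [aa]

lemma stufA_Pfun (z : ℂ) (k : ℕ+) (β : Comp → ℂ) (w : Comp) :
    stufA (Pfun z k) β w = TT (aa z k) β w := by
  unfold stufA
  apply HasSum.tsum_eq
  let g : ℕ+ × Comp → Comp × Comp := fun p => ([p.1], p.2)
  have hg : Function.Injective g := by
    rintro ⟨s, v⟩ ⟨s', v'⟩ h
    simpa [g] using h
  rw [← hg.hasSum_iff]
  · exact hasSum_single_stuf (aa z k) β w
  · rintro ⟨u, v⟩ hp
    match u with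
    | [] => simp [Pfun]
    | [s] => exact absurd ⟨(s, v), rfl⟩ hp
    | _ :: _ :: _ => simp [Pfun]

open PowerSeries in
lemma sum_range_eq_coeff (a : ℕ → ℂ) (h0 : a 0 = 0) (q : PowerSeries ℂ) (c : ℕ) :
    ∑ i ∈ Finset.range c, a (i + 1) * coeff (c - (i + 1)) q = coeff c (mk a * q) := by
  rw [coeff_mul, Finset.Nat.sum_antidiagonal_eq_sum_range_succ_mk, Finset.sum_range_succ']
  simp [h0]

open PowerSeries in
lemma stufPow_pre (z : ℂ) (k : ℕ+) (m : ℕ) (t : ℕ) (w : Comp) :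
    stufPow (Pfun z k) m (preN t w) = ∑ ij ∈ Finset.HasAntidiagonal.antidiagonal m,
      (m.choose ij.1 : ℂ) * (coeff t (mk (aa z k) ^ ij.1) * stufPow (Pfun z k) ij.2 w) := by
  have hz : ∀ m w, stufPow (Pfun z k) m w = ∑ ij ∈ Finset.HasAntidiagonal.antidiagonal m,
      (m.choose ij.1 : ℂ) *
        (coeff 0 (mk (aa z k) ^ ij.1) * stufPow (Pfun z k) ij.2 w) := by
    intro m w
    rw [Finset.sum_eq_single (0, m)]
    · simp
    · rintro ⟨i, j⟩ h1 h2
      have : i ≠ 0 := by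
        rintro rfl
        simp at h1 h2
        exact h2 h1
      simp [aa_zero, this]
    · simp
  induction m generalizing t w with
  | zero =>
    rcases Nat.eq_zero_or_pos t with rfl | ht
    · simpa [preN] using hz 0 w
    · simp [preN, ht, stufPow, coeff_one, ht.ne']
  | succ m ih =>
    rcases Nat.eq_zero_or_pos t with rfl | ht
    · simpa [preN] using hz (m + 1) w
    lift t to ℕ+ using ht
    have hcons : ∀ v, preN t v = t :: v := preN_coe t
    rw [hcons, Finset.sum_antidiagonal_choose_succ_mul
      (fun i j => coeff t (mk (aa z k) ^ i) * stufPow (Pfun z k) j w)]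
    have e1 : ∀ (n : ℕ) (v : Comp),
      stufPow (Pfun z k) (n + 1) v = TT (aa z k) (stufPow (Pfun z k) n) v := fun n v =>
        stufA_Pfun z k _ v
    rw [e1, TT, add_comm]
    have e2 : (fun v => stufPow (Pfun z k) m (t :: v)) = fun v =>
        ∑ ij ∈ Finset.HasAntidiagonal.antidiagonal m, ((m.choose ij.1 : ℂ) * coeff t (mk (aa z k) ^ ij.1)) *
          stufPow (Pfun z k) ij.2 v := by
      funext v
      rw [← hcons]
      rw [ih]
      exact Finset.sum_congr rfl fun ij _ => by ring
    rw [e2, TT_sum]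
    congr 1
    · refine Finset.sum_congr rfl fun ij _ => ?_
      rw [e1]; ring
    · simp only [ih, Finset.mul_sum]
      rw [Finset.sum_comm]
      refine Finset.sum_congr rfl fun ij hij => ?_
      rw [pow_succ', ← sum_range_eq_coeff _ (aa_zero z k), Finset.sum_mul, Finset.mul_sum]
      have : m.choose ij.2 = m.choose ij.1 := by
        rw [Finset.HasAntidiagonal.mem_antidiagonal] at hij
        exact Nat.choose_symm_of_eq_add (by omega)
      rw [this]
      refine Finset.sum_congr rfl fun i _ => by ring

open PowerSeries in
lemma coeff_pow_zero (a : ℕ → ℂ) (h0 : a 0 = 0) (c j : ℕ) (h : c < j) :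
    coeff c (mk a ^ j) = 0 := by
  have : (X : PowerSeries ℂ) ^ j ∣ mk a ^ j := pow_dvd_pow_of_dvd (X_dvd_iff.2 (by simp [h0])) j
  exact X_pow_dvd_iff.1 this c h

/-- The exponential of a power series without constant term. -/
noncomputable def EE (a : ℕ → ℂ) : PowerSeries ℂ :=
  PowerSeries.mk fun c => ∑ j ∈ Finset.range (c + 1),
    PowerSeries.coeff c (PowerSeries.mk a ^ j) / (j.factorial : ℂ)

open PowerSeries in
lemma EE_coeff (a : ℕ → ℂ) (h0 : a 0 = 0) (c n : ℕ) (h : c ≤ n) :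
    coeff c (EE a) = ∑ j ∈ Finset.range (n + 1), coeff c (mk a ^ j) / (j.factorial : ℂ) := by
  rw [EE, coeff_mk]
  refine Finset.sum_subset (by simpa using h) fun j _ hj => ?_
  rw [coeff_pow_zero a h0 c j (by simpa using hj), zero_div]

open PowerSeries in
lemma EE_deriv (a : ℕ → ℂ) (h0 : a 0 = 0) :
    derivative ℂ (EE a) = EE a * derivative ℂ (mk a) := by
  ext n
  rw [coeff_mul]
  have : ∀ ij ∈ Finset.HasAntidiagonal.antidiagonal n, coeff ij.1 (EE a) * coeff ij.2 (derivative ℂ (mk a)) =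
      ∑ j ∈ Finset.range (n + 1), coeff ij.1 (mk a ^ j) *
        coeff ij.2 (derivative ℂ (mk a)) / (j.factorial : ℂ) := by
    intro ij hij
    rw [EE_coeff a h0 ij.1 n (by have := Finset.HasAntidiagonal.mem_antidiagonal.1 hij; omega), Finset.sum_mul]
    exact Finset.sum_congr rfl fun j _ => by ring
  rw [Finset.sum_congr rfl this, Finset.sum_comm]
  simp only [← Finset.sum_div, ← coeff_mul]
  rw [coeff_derivative, EE, coeff_mk, Finset.sum_mul, Finset.sum_range_succ']
  have : coeff (n + 1) (1 : PowerSeries ℂ) = 0 := by simp [coeff_one]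
  simp only [pow_zero, this, zero_div, zero_mul, add_zero]
  refine Finset.sum_congr rfl fun j _ => ?_
  rw [div_mul_eq_mul_div, ← coeff_derivative, Derivation.leibniz_pow]
  rw [Nat.factorial_succ, Nat.add_sub_cancel, smul_eq_mul, map_nsmul, nsmul_eq_mul]
  have h1 : (j.factorial : ℂ) ≠ 0 := by exact_mod_cast j.factorial_ne_zero
  have h2 : ((j : ℂ) + 1) ≠ 0 := by exact_mod_cast j.succ_ne_zero
  push_cast
  field_simp

lemma aa_mul (z : ℂ) (k : ℕ+) (m : ℕ) (hm : m ≠ 0) :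
    aa z k m * m = if (k : ℕ) ∣ m then -(k : ℂ) * (-z) ^ (m / (k : ℕ)) else 0 := by
  unfold aa
  split_ifs with h
  · obtain ⟨n, rfl⟩ := h
    have hn : (n : ℂ) ≠ 0 := by
      rintro h
      apply hm
      have : n = 0 := by exact_mod_cast h
      simp [this]
    rw [Nat.mul_div_cancel_left _ k.pos]
    push_cast
    field_simp
  · simp

open PowerSeries in
lemma log_ode (z : ℂ) (k : ℕ+) :
    derivative ℂ (mk (aa z k)) * (1 + C z * X ^ (k : ℕ)) =
      derivative ℂ (1 + C z * X ^ (k : ℕ) : PowerSeries ℂ) := by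
  have hk := k.pos
  ext n
  rw [mul_add, mul_one, ← mul_assoc, map_add, coeff_mul_X_pow', coeff_derivative, coeff_derivative,
    coeff_mk, map_add, coeff_C_mul, coeff_X_pow, coeff_one, mul_comm _ (C z), coeff_C_mul]
  have e : ∀ n : ℕ, aa z k (n + 1) * ((n : ℂ) + 1) = _ := fun n => by
    have := aa_mul z k (n + 1) (Nat.succ_ne_zero _)
    push_cast at this
    exact this
  rw [e]
  have hkC : ∀ m : ℕ, m + 1 = k → (m : ℂ) + 1 = (k : ℂ) := fun m h => by exact_mod_cast h
  rw [if_neg (Nat.succ_ne_zero n), zero_add]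
  by_cases h1 : (k : ℕ) ≤ n
  · obtain ⟨m, rfl⟩ := Nat.exists_eq_add_of_le h1
    rw [if_pos h1, Nat.add_sub_cancel_left, coeff_derivative, coeff_mk, e,
      if_neg (show ¬ ((k : ℕ) + m + 1 = k) by omega)]
    have h2 : (k : ℕ) ∣ k + m + 1 ↔ (k : ℕ) ∣ m + 1 := by
      rw [add_assoc, Nat.dvd_add_right (dvd_refl _)]
    have h3 : ((k : ℕ) + m + 1) / k = (m + 1) / k + 1 := by
      rw [add_assoc, Nat.add_div_left _ hk]
    simp only [h2, h3]
    split_ifs <;> ring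
  · rw [if_neg h1, add_zero]
    by_cases h2 : n + 1 = k
    · rw [if_pos h2, if_pos (h2 ▸ dvd_refl _), hkC n h2, h2, Nat.div_self hk]
      ring
    · rw [if_neg h2, if_neg]
      · ring
      · intro h
        have := Nat.le_of_dvd (Nat.succ_pos n) h
        omega

open PowerSeries in
lemma EE_eq (z : ℂ) (k : ℕ+) : EE (aa z k) = 1 + C z * X ^ (k : ℕ) := by
  set Q : PowerSeries ℂ := 1 + C z * X ^ (k : ℕ) with hQ
  have hk := k.pos.ne'
  have hc : constantCoeff Q = 1 := by simp [hQ, hk]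
  have hQ1 : Q * Q⁻¹ = 1 := PowerSeries.mul_inv_cancel _ (by simp [hc])
  have hE0 : constantCoeff (EE (aa z k)) = 1 := by
    rw [← coeff_zero_eq_constantCoeff_apply, EE, coeff_mk]
    simp
  have : EE (aa z k) * Q⁻¹ = 1 := by
    apply derivative.ext
    · have h1 := EE_deriv (aa z k) (aa_zero z k)
      have h2 := log_ode z k
      rw [← hQ] at h2
      have h3 : derivative ℂ (Q * Q⁻¹) = 0 := by rw [hQ1]; simp
      simp only [Derivation.leibniz, smul_eq_mul, Derivation.map_one_eq_zero] at h3 ⊢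
      rw [h1]
      rw [← h2] at h3
      linear_combination (EE (aa z k) * Q⁻¹) * h3 -
        (EE (aa z k) * (derivative ℂ Q⁻¹) + EE (aa z k) * Q⁻¹ * derivative ℂ (mk (aa z k))) * hQ1
    · simp [hE0, hc]
  calc EE (aa z k) = EE (aa z k) * (Q * Q⁻¹) := by rw [hQ1, mul_one]
    _ = Q * (EE (aa z k) * Q⁻¹) := by ring
    _ = Q := by rw [this, mul_one]

open PowerSeries in
lemma hasSum_letter (z : ℂ) (k c : ℕ+) :
    ∑' j : ℕ, coeff (c : ℕ) (mk (aa z k) ^ j) / (j.factorial : ℂ) = if c = k then z else 0 := by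
  rw [tsum_eq_sum (s := Finset.range ((c : ℕ) + 1)), ← EE_coeff _ (aa_zero z k) _ _ le_rfl, EE_eq]
  · simp [coeff_one, coeff_X_pow]
  · intro j hj
    rw [coeff_pow_zero _ (aa_zero z k) _ _ (by simpa using hj), zero_div]

open PowerSeries in
lemma summable_letter (z : ℂ) (k c : ℕ+) :
    Summable fun j : ℕ => ‖coeff (c : ℕ) (mk (aa z k) ^ j) / (j.factorial : ℂ)‖ := by
  apply summable_of_ne_finset_zero (s := Finset.range ((c : ℕ) + 1))
  intro j hj
  rw [coeff_pow_zero _ (aa_zero z k) _ _ (by simpa using hj), zero_div, norm_zero]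

open PowerSeries in
lemma stufPow_cons_div (z : ℂ) (k c : ℕ+) (w : Comp) (m : ℕ) :
    stufPow (Pfun z k) m (c :: w) / (m.factorial : ℂ) = ∑ ij ∈ Finset.HasAntidiagonal.antidiagonal m,
      (coeff (c : ℕ) (mk (aa z k) ^ ij.1) / (ij.1.factorial : ℂ)) *
        (stufPow (Pfun z k) ij.2 w / (ij.2.factorial : ℂ)) := by
  have h := stufPow_pre z k m c w
  rw [preN_coe] at h
  rw [h, Finset.sum_div]
  refine Finset.sum_congr rfl fun ij hij => ?_
  rw [Finset.HasAntidiagonal.mem_antidiagonal] at hij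
  obtain ⟨i, j⟩ := ij
  simp only at hij ⊢
  subst hij
  have h0 : ((i + j).choose i : ℂ) * i.factorial * j.factorial = (i + j).factorial := by
    have := Nat.add_choose_mul_factorial_mul_factorial i j
    rw [← Nat.choose_symm_add] at this
    exact_mod_cast this
  have h1 : (i.factorial : ℂ) ≠ 0 := by exact_mod_cast i.factorial_ne_zero
  have h2 : (j.factorial : ℂ) ≠ 0 := by exact_mod_cast j.factorial_ne_zero
  have h3 : ((i + j).factorial : ℂ) ≠ 0 := by exact_mod_cast (i + j).factorial_ne_zero
  field_simp
  rw [← h0]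
  ring

lemma cauchy_aux (f g : ℕ → ℂ) (hf : Summable fun n => ‖f n‖) (hg : Summable fun n => ‖g n‖) :
    (Summable fun n => ‖∑ ij ∈ Finset.HasAntidiagonal.antidiagonal n, f ij.1 * g ij.2‖) ∧
    ∑' n, ∑ ij ∈ Finset.HasAntidiagonal.antidiagonal n, f ij.1 * g ij.2 =
      (∑' n, f n) * ∑' n, g n :=
  ⟨summable_norm_sum_mul_antidiagonal_of_summable_norm hf hg,
    (tsum_mul_tsum_eq_tsum_sum_antidiagonal_of_summable_norm hf hg).symm⟩

lemma main_aux (z : ℂ) (k : ℕ+) (w : Comp) :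
    (Summable fun m : ℕ => ‖stufPow (Pfun z k) m w / (m.factorial : ℂ)‖) ∧
    expStuf (Pfun z k) w = if ∀ p ∈ w, p = k then z ^ w.length else 0 := by
  unfold expStuf
  induction w with
  | nil =>
    have h0 : ∀ m : ℕ, m ≠ 0 → stufPow (Pfun z k) m [] = 0 := by
      intro m hm
      obtain ⟨n, rfl⟩ := Nat.exists_eq_succ_of_ne_zero hm
      exact (stufA_Pfun z k _ []).trans rfl
    constructor
    · apply summable_of_ne_finset_zero (s := {0})
      intro m hm
      simp [h0 m (by simpa using hm)]
    · rw [tsum_eq_single 0]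
      · simp [stufPow]
      · intro m hm
        simp [h0 m hm]
  | cons c w ih =>
    obtain ⟨ih1, ih2⟩ := ih
    simp only [stufPow_cons_div]
    have h := cauchy_aux (fun j : ℕ => PowerSeries.coeff (c : ℕ) (PowerSeries.mk (aa z k) ^ j) /
      (j.factorial : ℂ)) (fun m : ℕ => stufPow (Pfun z k) m w / (m.factorial : ℂ))
      (summable_letter z k c) ih1
    refine ⟨h.1, h.2.trans ?_⟩
    rw [ih2, hasSum_letter]
    by_cases h : c = k
    · simp [h, pow_succ']
    · simp [h]

/-- `exp_⧛(P) = (z·y_k)*`: the stuffle exponential of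
`P = −Σ_{n≥1} y_{nk} (−z)ⁿ/n` is the Kleene star of `z·y_k`, i.e. it equals
`z^{length(w)}` on compositions all of whose parts are `k`, and `0` elsewhere. -/
theorem expStuf_eq_kleene_star (z : ℂ) (k : ℕ+) (w : Comp) :
    expStuf (Pfun z k) w =
      if ∀ p ∈ w, p = k then z ^ w.length else 0 := by
  exact (main_aux z k w).2
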